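/- Let g be a generalized Hermite kernel of order k with homogeneity exponent α satisfying ∫_{(0,1]^k} |g(x)| dx < ∞, and fix t > 0. With g_n = g·1_{(0,n]^k}, h_{t,n}(x) = ∫_0^t g_n(s·1 − x) ds, h_t(x) = ∫_0^t g(s·1 − x) ds, and ĝ_n(u) = ∫_{ℝ^k} g_n(x) e^{i⟨u,x⟩} dx, the following hold: (i) h_{t,n} → h_t in L²(ℝ^k) as n → ∞; (ii) there exists a measurable function ĝ : ℝ^k → ℂ, independent of t, such that the functions u ↦ ((e^{it⟨u,1⟩} − 1)/(i⟨u,1⟩)) ĝ_n(−u) converge in L²(ℝ^k) to u ↦ ((e^{it⟨u,1⟩} − 1)/(i⟨u,1⟩)) ĝ(−u), and a subsequence of (ĝ_n) converges to ĝ almost everywhere on ℝ^k. -/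

import Mathlib

open MeasureTheory Filter

noncomputable section

/-- The open positive orthant `(0,∞)^k` in `ℝ^k`. -/
def posOrthant (k : ℕ) : Set (Fin k → ℝ) := {x | ∀ j, 0 < x j}

/-- A generalized Hermite kernel of order `k` with homogeneity exponent `α`:
a nonzero measurable function on `(0,∞)^k`, extended by `0` off the positive orthant,
homogeneous of exponent `α ∈ (-(k+1)/2, -k/2)`, satisfying the integrability condition
`∫_{(0,∞)^k} |g(x) g(1+x)| dx < ∞`. -/
structure IsGenHermiteKernel (k : ℕ) (α : ℝ) (g : (Fin k → ℝ) → ℝ) : Prop where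
  measurable : Measurable g
  zero_off : ∀ x : Fin k → ℝ, x ∉ posOrthant k → g x = 0
  nonzero : ¬ (∀ᵐ x ∂(volume.restrict (posOrthant k)), g x = 0)
  homog : ∀ lam : ℝ, 0 < lam → ∀ x ∈ posOrthant k, g (lam • x) = lam ^ α * g x
  alpha_lb : -((k : ℝ) + 1) / 2 < α
  alpha_ub : α < -(k : ℝ) / 2
  int_cond : IntegrableOn (fun x => g x * g (1 + x)) (posOrthant k) volume

/-- `h_t(x) = ∫_0^t g(s·1 − x) ds`. -/
def hKer {k : ℕ} (g : (Fin k → ℝ) → ℝ) (t : ℝ) (x : Fin k → ℝ) : ℝ :=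
  ∫ s in Set.Ioc (0 : ℝ) t, g (fun j => s - x j)

/-- The truncation `g·1_{(0,r]^k}` of `g`. -/
def gCut {k : ℕ} (g : (Fin k → ℝ) → ℝ) (r : ℝ) : (Fin k → ℝ) → ℝ :=
  Set.indicator {x : Fin k → ℝ | ∀ j, x j ∈ Set.Ioc (0 : ℝ) r} g

/-- The Fourier transform `ĝ_r(u) = ∫ g_r(x) e^{i⟨u,x⟩} dx` of the truncation. -/
def gCutHat {k : ℕ} (g : (Fin k → ℝ) → ℝ) (r : ℝ) (u : Fin k → ℝ) : ℂ :=
  ∫ x : Fin k → ℝ, (gCut g r x : ℂ) * Complex.exp (Complex.I * ((∑ j, u j * x j : ℝ) : ℂ))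

/-- `h_{t,r}(x) = ∫_0^t g_r(s·1 − x) ds` with `g_r = g·1_{(0,r]^k}`. -/
def hKerCut {k : ℕ} (g : (Fin k → ℝ) → ℝ) (r t : ℝ) (x : Fin k → ℝ) : ℝ :=
  ∫ s in Set.Ioc (0 : ℝ) t, gCut g r (fun j => s - x j)

/-- The spectral factor `(e^{it⟨u,1⟩} − 1)/(i⟨u,1⟩)`, interpreted as `t` when `⟨u,1⟩ = 0`. -/
def specFactor {k : ℕ} (t : ℝ) (u : Fin k → ℝ) : ℂ :=
  if (∑ j, u j) = 0 then (t : ℂ)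
  else (Complex.exp (Complex.I * (t : ℂ) * ((∑ j, u j : ℝ) : ℂ)) - 1) /
    (Complex.I * ((∑ j, u j : ℝ) : ℂ))

open FourierTransform SchwartzMap in
lemma planch_aux {V : Type*} [NormedAddCommGroup V] [InnerProductSpace ℝ V] [FiniteDimensional ℝ V]
    [MeasurableSpace V] [BorelSpace V] {f : V → ℂ} (h1 : Integrable f) (h2 : MemLp f 2) :
    eLpNorm (𝓕 f) 2 volume = eLpNorm f 2 volume := by
  set F : Lp ℂ 2 (volume : Measure V) := h2.toLp f with hF
  have key : (𝓕 f) =ᵐ[volume] ((𝓕 F : Lp ℂ 2 (volume : Measure V)) : V → ℂ) := by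
    have hc : Continuous (𝓕 f) := VectorFourier.fourierIntegral_continuous
      Real.continuous_fourierChar (by exact continuous_inner) h1
    have hL1 : LocallyIntegrable (𝓕 f) (volume : Measure V) := hc.locallyIntegrable
    have hL2 : LocallyIntegrable ((𝓕 F : Lp ℂ 2 (volume : Measure V)) : V → ℂ) volume :=
      (Lp.memLp _).locallyIntegrable (by norm_num)
    have := ae_eq_zero_of_integral_contDiff_smul_eq_zero (hL1.sub hL2) ?_
    · filter_upwards [this] with x hx
      simpa [sub_eq_zero] using hx
    intro g gs gc
    have hg₁ : HasCompactSupport (Complex.ofRealCLM ∘ g) := gc.comp_left rfl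
    have hg₂ : ContDiff ℝ (⊤ : ℕ∞) (Complex.ofRealCLM ∘ g) := by fun_prop
    set φ : 𝓢(V, ℂ) := hg₁.toSchwartzMap hg₂ with hφ
    have e1 : ∫ x, φ x • (𝓕 F : Lp ℂ 2 (volume : Measure V)) x = ∫ x, (𝓕 φ) x • F x := by
      rw [← Lp.toTemperedDistribution_apply, ← Lp.fourier_toTemperedDistribution_eq,
        TemperedDistribution.fourier_apply, Lp.toTemperedDistribution_apply]
    have e2 : ∫ x, (𝓕 φ) x • F x = ∫ x, (𝓕 φ) x • f x := by
      apply integral_congr_ae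
      filter_upwards [h2.coeFn_toLp] with x hx
      rw [hF, hx]
    have e3 : ∫ x, (𝓕 φ) x • f x = ∫ x, φ x • 𝓕 f x := by
      have := VectorFourier.integral_fourierIntegral_smul_eq_flip (L := innerₗ V)
        Real.continuous_fourierChar (by exact continuous_inner) (φ.integrable (μ := volume)) h1
      rw [flip_innerₗ] at this
      exact this
    have i1 : Integrable (fun x => g x • 𝓕 f x) :=
      hL1.integrable_smul_left_of_hasCompactSupport gs.continuous gc
    have i2 : Integrable (fun x => g x • (𝓕 F : Lp ℂ 2 (volume : Measure V)) x) :=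
      hL2.integrable_smul_left_of_hasCompactSupport gs.continuous gc
    simp only [Pi.sub_apply, smul_sub]
    rw [integral_sub i1 i2, sub_eq_zero]
    have := (e1.trans (e2.trans e3)).symm
    simpa [φ] using this
  rw [eLpNorm_congr_ae key]
  have := Lp.norm_fourier_eq F
  rw [Lp.norm_def, Lp.norm_def, ENNReal.toReal_eq_toReal_iff' (Lp.eLpNorm_ne_top _) (Lp.eLpNorm_ne_top _)] at this
  rw [this, hF, eLpNorm_congr_ae h2.coeFn_toLp]

def FT {k : ℕ} (f : (Fin k → ℝ) → ℂ) (u : Fin k → ℝ) : ℂ :=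
  ∫ x : Fin k → ℝ, f x * Complex.exp (Complex.I * ((∑ j, u j * x j : ℝ) : ℂ))

lemma planch (k : ℕ) : ∃ c : ENNReal, c ≠ ⊤ ∧ ∀ f : (Fin k → ℝ) → ℂ, Integrable f →
    eLpNorm (FT f) 2 volume ≤ c * eLpNorm f 2 volume := by
  set r : ℝ := -(2 * Real.pi)⁻¹ with hr
  have hr0 : r ≠ 0 := by simp [hr, Real.pi_ne_zero]
  set E := EuclideanSpace ℝ (Fin k)
  set d : ENNReal := ENNReal.ofReal (abs (r ^ Module.finrank ℝ E)⁻¹) with hd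
  have hd0 : d ≠ 0 := by simp [hd, hr0]
  have hmp : MeasurePreserving (WithLp.toLp 2 : (Fin k → ℝ) → E) :=
    PiLp.volume_preserving_toLp (Fin k)
  have hmp' : MeasurePreserving (WithLp.ofLp : E → (Fin k → ℝ)) :=
    PiLp.volume_preserving_ofLp (Fin k)
  refine ⟨d ^ (1/2 : ℝ) + 1, by simp [hd], fun f hf => ?_⟩
  by_cases h2 : eLpNorm f 2 volume = ⊤
  · rw [h2, ENNReal.mul_top (by simp)]; exact le_top
  set F : E → ℂ := fun x => f (WithLp.ofLp x) with hF
  have hF1 : Integrable F := hmp'.integrable_comp_of_integrable hf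
  have hFm : eLpNorm F 2 volume = eLpNorm f 2 volume :=
    eLpNorm_comp_measurePreserving hf.1 hmp'
  have hF2 : MemLp F 2 := ⟨hF1.1, by rw [hFm]; exact lt_top_iff_ne_top.2 h2⟩
  have hP := planch_aux hF1 hF2
  have hc : Continuous (FourierTransform.fourier F) := VectorFourier.fourierIntegral_continuous
      Real.continuous_fourierChar (by exact continuous_inner) hF1
  have e : FT f = (fun x : E => FourierTransform.fourier F (r • x)) ∘ (WithLp.toLp 2) := by
    ext u
    simp only [Function.comp, FT]
    rw [Real.fourier_eq', ← hmp.integral_comp (MeasurableEquiv.toLp 2 (Fin k → ℝ)).measurableEmbedding]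
    apply integral_congr_ae
    refine ae_of_all _ fun x => ?_
    simp only [hF, smul_eq_mul]
    rw [mul_comm]
    congr 2
    rw [mul_comm Complex.I]
    congr 2
    have h0 : inner ℝ (WithLp.toLp 2 x : E) (WithLp.toLp 2 u : E) = ∑ j, u j * x j :=
      PiLp.inner_apply (𝕜 := ℝ) _ _
    rw [inner_smul_right, h0, hr]
    field_simp
  rw [e, eLpNorm_comp_measurePreserving (by exact (hc.comp (continuous_const_smul r)).aestronglyMeasurable) hmp]
  have e2 : eLpNorm (fun x : E => FourierTransform.fourier F (r • x)) 2 volume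
      = d ^ (1/2 : ℝ) * eLpNorm (FourierTransform.fourier F) 2 volume := by
    have := eLpNorm_map_measure (p := 2) (μ := (volume : Measure E)) (f := fun x : E => r • x)
      (g := FourierTransform.fourier F) hc.aestronglyMeasurable (by fun_prop)
    rw [Measure.map_addHaar_smul _ hr0, eLpNorm_smul_measure_of_ne_zero hd0] at this
    simp only [Function.comp_def] at this
    rw [← this]
    simp [d]
  rw [e2, hP, hFm]
  gcongr
  exact le_self_add

lemma meas_posOrthant (k : ℕ) : MeasurableSet (posOrthant k) := by
  unfold posOrthant
  simp only [Set.ofPred_forall]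
  exact MeasurableSet.iInter fun j => measurableSet_lt measurable_const (measurable_pi_apply j)

lemma meas_box (k : ℕ) (r : ℝ) : MeasurableSet {x : Fin k → ℝ | ∀ j, x j ∈ Set.Ioc (0 : ℝ) r} := by
  simp only [Set.ofPred_forall]
  exact MeasurableSet.iInter fun j => measurable_pi_apply j measurableSet_Ioc

lemma lint_scale {k : ℕ} (f : (Fin k → ℝ) → ENNReal) (hf : Measurable f) {d : ℝ} (hd : 0 < d) :
    ∫⁻ y, f y = ENNReal.ofReal (d ^ (k : ℝ)) * ∫⁻ z, f (d • z) := by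
  have h := lintegral_map (μ := (volume : Measure (Fin k → ℝ))) hf
    (measurable_const_smul d)
  rw [← h, Measure.map_addHaar_smul _ hd.ne', lintegral_smul_measure, smul_eq_mul, ← mul_assoc,
    ← ENNReal.ofReal_mul (by positivity)]
  have : d ^ (k : ℝ) * |(d ^ Module.finrank ℝ (Fin k → ℝ))⁻¹| = 1 := by
    rw [Real.rpow_natCast, abs_of_pos (by positivity)]
    simp
    field_simp
  rw [this]; simp

section
variable {k : ℕ} {α : ℝ} {g : (Fin k → ℝ) → ℝ}

/-- total mass -/
def CC (g : (Fin k → ℝ) → ℝ) : ENNReal := ∫⁻ z, ‖g z‖ₑ * ‖g (1 + z)‖ₑ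

lemma CC_lt_top (hg : IsGenHermiteKernel k α g) : CC g < ⊤ := by
  have h := hg.int_cond.2
  rw [hasFiniteIntegral_iff_enorm, ← lintegral_indicator (meas_posOrthant k)] at h
  refine lt_of_le_of_lt (lintegral_mono fun z => ?_) h
  by_cases hz : z ∈ posOrthant k
  · simp [hz, enorm_mul]
  · simp [hz, hg.zero_off z hz]

lemma homog_enorm (hg : IsGenHermiteKernel k α g) {d : ℝ} (hd : 0 < d) (x : Fin k → ℝ) :
    ‖g (d • x)‖ₑ = ENNReal.ofReal (d ^ α) * ‖g x‖ₑ := by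
  by_cases hx : x ∈ posOrthant k
  · rw [hg.homog d hd x hx, enorm_mul, Real.enorm_of_nonneg (by positivity)]
  · rw [hg.zero_off x hx, hg.zero_off]
    · simp
    · intro h
      apply hx
      intro j
      have := h j
      simp only [Pi.smul_apply, smul_eq_mul] at this
      exact (mul_pos_iff_of_pos_left hd).1 this

lemma inner_lt (hg : IsGenHermiteKernel k α g) {s s' : ℝ} (h : s < s') :
    ∫⁻ x : Fin k → ℝ, ‖g (fun j => s - x j)‖ₑ * ‖g (fun j => s' - x j)‖ₑ =
      ENNReal.ofReal (|s' - s| ^ (2 * α + k)) * CC g := by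
  have hm := hg.measurable
  set d := s' - s with hd
  have hd0 : 0 < d := by linarith
  have e1 := lintegral_sub_left_eq_self (μ := (volume : Measure (Fin k → ℝ)))
    (fun y => ‖g y‖ₑ * ‖g (fun j => d + y j)‖ₑ) (fun _ => s)
  have e2 : ∫⁻ x : Fin k → ℝ, ‖g (fun j => s - x j)‖ₑ * ‖g (fun j => s' - x j)‖ₑ
      = ∫⁻ y : Fin k → ℝ, ‖g y‖ₑ * ‖g (fun j => d + y j)‖ₑ := by
    rw [← e1]
    apply lintegral_congr
    intro x
    congr 2
    congr 1
    ext j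
    simp [hd]
  have hmm : Measurable (fun y : Fin k → ℝ => ‖g y‖ₑ * ‖g (fun j => d + y j)‖ₑ) := by
    refine hm.enorm.mul (Measurable.enorm (hm.comp ?_))
    exact measurable_pi_lambda _ fun j => by fun_prop
  rw [e2, lint_scale _ hmm hd0]
  have e3 : ∀ z : Fin k → ℝ, ‖g (d • z)‖ₑ * ‖g (fun j => d + (d • z) j)‖ₑ =
      ENNReal.ofReal (d ^ (2 * α)) * (‖g z‖ₑ * ‖g (1 + z)‖ₑ) := by
    intro z
    have : (fun j => d + (d • z) j) = d • (1 + z) := by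
      ext j; simp [mul_add]
    rw [this, homog_enorm hg hd0, homog_enorm hg hd0, two_mul, Real.rpow_add hd0,
      ENNReal.ofReal_mul (by positivity)]
    ring
  simp_rw [e3]
  rw [lintegral_const_mul _ (by exact hm.enorm.mul (hm.comp (measurable_const_add 1)).enorm),
    ← mul_assoc, ← ENNReal.ofReal_mul (by positivity), ← Real.rpow_add hd0, abs_of_pos hd0,
    add_comm (k : ℝ)]
  rfl

lemma inner_ne (hg : IsGenHermiteKernel k α g) {s s' : ℝ} (h : s' ≠ s) :
    ∫⁻ x : Fin k → ℝ, ‖g (fun j => s - x j)‖ₑ * ‖g (fun j => s' - x j)‖ₑ =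
      ENNReal.ofReal (|s' - s| ^ (2 * α + k)) * CC g := by
  rcases lt_or_gt_of_ne h with h | h
  · rw [abs_sub_comm, ← inner_lt hg h]
    simp_rw [mul_comm]
  · exact inner_lt hg h

lemma rpow_fin {p : ℝ} (hp : -1 < p) {t : ℝ} (ht : 0 < t) :
    ∫⁻ v in Set.Icc (-t) t, ENNReal.ofReal (|v| ^ p) < ⊤ := by
  have h1 : ∫⁻ v in Set.Ioc 0 t, ENNReal.ofReal (|v| ^ p) < ⊤ := by
    have := (intervalIntegral.intervalIntegrable_rpow' (a := 0) (b := t) hp).1.2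
    rw [hasFiniteIntegral_iff_enorm] at this
    refine lt_of_le_of_lt (le_of_eq ?_) this
    apply setLIntegral_congr_fun measurableSet_Ioc
    intro v hv
    simp only
    rw [abs_of_pos hv.1, Real.enorm_of_nonneg (Real.rpow_nonneg hv.1.le _)]
  have h2 : ∫⁻ v in Set.Ico (-t) 0, ENNReal.ofReal (|v| ^ p) < ⊤ := by
    have := (Measure.measurePreserving_neg (volume : Measure ℝ)).setLIntegral_comp_preimage_emb
      (MeasurableEquiv.neg ℝ).measurableEmbedding (fun v => ENNReal.ofReal (|v| ^ p)) (Set.Ioc 0 t)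
    simp only [abs_neg] at this
    rw [← this] at h1
    convert h1 using 3
    simp
  have h3 : ∫⁻ v in ({0} : Set ℝ), ENNReal.ofReal (|v| ^ p) < ⊤ := by
    rw [setLIntegral_measure_zero _ _ (by simp)]; simp
  have hs : Set.Icc (-t) t ⊆ (Set.Ioc 0 t ∪ Set.Ico (-t) 0) ∪ {0} := by
    intro v hv
    rcases lt_trichotomy v 0 with h | h | h
    · left; right; exact ⟨hv.1, h⟩
    · right; exact h
    · left; left; exact ⟨h, hv.2⟩
  refine lt_of_le_of_lt (lintegral_mono_set hs) ?_
  refine lt_of_le_of_lt (lintegral_union_le _ _ _) (ENNReal.add_lt_top.2 ⟨?_, h3⟩)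
  exact lt_of_le_of_lt (lintegral_union_le _ _ _) (ENNReal.add_lt_top.2 ⟨h1, h2⟩)

/-- dominating function -/
def HH (g : (Fin k → ℝ) → ℝ) (t : ℝ) (x : Fin k → ℝ) : ENNReal :=
  ∫⁻ s in Set.Ioc (0 : ℝ) t, ‖g (fun j => s - x j)‖ₑ

lemma meas_shift {f : (Fin k → ℝ) → ℝ} (hm : Measurable f) :
    Measurable (fun q : (Fin k → ℝ) × ℝ => f (fun j => q.2 - q.1 j)) := by
  refine hm.comp (measurable_pi_lambda _ fun j => ?_)
  exact measurable_snd.sub ((measurable_pi_apply j).comp measurable_fst)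

lemma meas_HH (hm : Measurable g) (t : ℝ) : Measurable (HH g t) :=
  Measurable.lintegral_prod_right' (f := fun q : (Fin k → ℝ) × ℝ => ‖g (fun j => q.2 - q.1 j)‖ₑ)
    (meas_shift hm).enorm

lemma HH_sq (hg : IsGenHermiteKernel k α g) {t : ℝ} (ht : 0 < t) :
    ∫⁻ x, HH g t x ^ 2 < ⊤ := by
  have hm := hg.measurable
  set μ := (volume : Measure ℝ).restrict (Set.Ioc (0 : ℝ) t) with hμ
  have hS : Measurable (fun q : (Fin k → ℝ) × ℝ × ℝ =>
      ‖g (fun j => q.2.1 - q.1 j)‖ₑ * ‖g (fun j => q.2.2 - q.1 j)‖ₑ) := by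
    have m1 := ((meas_shift hm).comp ((measurable_fst (α := Fin k → ℝ) (β := ℝ × ℝ)).prodMk
      measurable_snd.fst)).enorm
    have m2 := ((meas_shift hm).comp ((measurable_fst (α := Fin k → ℝ) (β := ℝ × ℝ)).prodMk
      measurable_snd.snd)).enorm
    exact m1.mul m2
  have hsec : ∀ x : Fin k → ℝ, Measurable (fun s : ℝ => ‖g (fun j => s - x j)‖ₑ) := fun x =>
    ((meas_shift hm).comp (measurable_const.prodMk measurable_id)).enorm
  have e1 : ∀ x, HH g t x ^ 2 = ∫⁻ q, ‖g (fun j => q.1 - x j)‖ₑ * ‖g (fun j => q.2 - x j)‖ₑ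
      ∂(μ.prod μ) := by
    intro x
    rw [lintegral_prod_mul (f := fun s => ‖g (fun j => s - x j)‖ₑ)
      (g := fun s => ‖g (fun j => s - x j)‖ₑ) (hsec x).aemeasurable (hsec x).aemeasurable, sq]
    rfl
  simp_rw [e1]
  rw [lintegral_lintegral_swap hS.aemeasurable, lintegral_prod _
    (Measurable.lintegral_prod_left' hS).aemeasurable]
  have hp : -1 < 2 * α + k := by linarith [hg.alpha_lb]
  set B := ∫⁻ v in Set.Icc (-t) t, ENNReal.ofReal (|v| ^ (2 * α + k)) with hB
  have hB' : B < ⊤ := rpow_fin hp ht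
  have bound : ∀ s ∈ Set.Ioc (0 : ℝ) t, ∫⁻ s', (∫⁻ x : Fin k → ℝ,
      ‖g (fun j => s - x j)‖ₑ * ‖g (fun j => s' - x j)‖ₑ) ∂μ ≤ B * CC g := by
    intro s hs
    have hne : ∀ᵐ s' ∂μ, s' ≠ s := by
      apply ae_restrict_of_ae
      simp [ae_iff]
    have hpm : Measurable fun v : ℝ => ENNReal.ofReal (|v| ^ (2 * α + k)) := by fun_prop
    calc _ = ∫⁻ s', ENNReal.ofReal (|s' - s| ^ (2 * α + k)) * CC g ∂μ := by
            apply lintegral_congr_ae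
            filter_upwards [hne] with s' h
            exact inner_ne hg h
      _ = (∫⁻ s', ENNReal.ofReal (|s' - s| ^ (2 * α + k)) ∂μ) * CC g := by
            rw [lintegral_mul_const _ (by fun_prop)]
      _ ≤ B * CC g := by
            gcongr
            rw [hB, hμ, ← lintegral_indicator measurableSet_Ioc, ← lintegral_indicator measurableSet_Icc]
            rw [← lintegral_sub_right_eq_self (μ := (volume : Measure ℝ)) (fun v => (Set.Icc (-t) t).indicator
              (fun v => ENNReal.ofReal (|v| ^ (2 * α + k))) v) s]
            apply lintegral_mono
            intro s'
            by_cases h : s' ∈ Set.Ioc (0 : ℝ) t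
            · have : s' - s ∈ Set.Icc (-t) t := by
                constructor <;> linarith [h.1, h.2, hs.1, hs.2]
              simp [h, this]
            · simp [h]
  refine lt_of_le_of_lt (setLIntegral_mono' measurableSet_Ioc bound) ?_
  rw [setLIntegral_const]
  exact ENNReal.mul_lt_top (ENNReal.mul_lt_top hB' (CC_lt_top hg)) (by simp)

lemma meas_gCut (hm : Measurable g) (r : ℝ) : Measurable (gCut g r) :=
  hm.indicator (meas_box k r)

lemma meas_hKer {f : (Fin k → ℝ) → ℝ} (hm : Measurable f) (t : ℝ) :
    StronglyMeasurable (hKer f t) :=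
  StronglyMeasurable.integral_prod_right' (f := fun q : (Fin k → ℝ) × ℝ => f (fun j => q.2 - q.1 j))
    (meas_shift hm).stronglyMeasurable

lemma hKerCut_eq (r t : ℝ) : hKerCut g r t = hKer (gCut g r) t := rfl

lemma gCut_enorm_le (r : ℝ) (x : Fin k → ℝ) : ‖gCut g r x‖ₑ ≤ ‖g x‖ₑ :=
  enorm_indicator_le_enorm_self _ _

lemma gCut_tendsto (hg : IsGenHermiteKernel k α g) (x : Fin k → ℝ) :
    Tendsto (fun n : ℕ => gCut g n x) atTop (nhds (g x)) := by
  by_cases hx : x ∈ posOrthant k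
  · obtain ⟨N, hN⟩ := exists_nat_ge (∑ j, |x j|)
    apply tendsto_const_nhds.congr'
    filter_upwards [eventually_ge_atTop N] with n hn
    rw [gCut, Set.indicator_of_mem]
    intro j
    refine ⟨hx j, (le_abs_self _).trans ?_⟩
    have h1 := Finset.single_le_sum (f := fun j => |x j|) (fun i _ => abs_nonneg _) (Finset.mem_univ j)
    have h2 : (N : ℝ) ≤ n := by exact_mod_cast hn
    linarith
  · have : ∀ r, gCut g r x = 0 := fun r => by
      simp [gCut, Set.indicator, hg.zero_off x hx]
    simp [this, hg.zero_off x hx]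

lemma part_i (hg : IsGenHermiteKernel k α g) {t : ℝ} (ht : 0 < t) :
    Tendsto (fun n : ℕ =>
        eLpNorm (fun x => hKerCut g n t x - hKer g t x) 2 volume) atTop (nhds 0) := by
  have hm := hg.measurable
  have hsec : ∀ {f : (Fin k → ℝ) → ℝ}, Measurable f → ∀ x : Fin k → ℝ,
      Measurable (fun s : ℝ => f (fun j => s - x j)) := fun hf x =>
    ((meas_shift hf).comp (measurable_const.prodMk measurable_id))
  have hfin : ∀ᵐ x : Fin k → ℝ, HH g t x < ⊤ := by
    have := ae_lt_top ((meas_HH hm t).pow_const 2) (HH_sq hg ht).ne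
    filter_upwards [this] with x hx
    by_contra h
    simp only [not_lt, top_le_iff] at h
    simp [h] at hx
  have key : Tendsto (fun n : ℕ => ∫⁻ x, ‖hKerCut g n t x - hKer g t x‖ₑ ^ 2) atTop
      (nhds (∫⁻ x : Fin k → ℝ, 0)) := by
    apply tendsto_lintegral_of_dominated_convergence (fun x => (2 * HH g t x) ^ 2)
    · intro n
      exact (((meas_hKer (meas_gCut hm n) t).sub (meas_hKer hm t)).enorm.pow_const 2)
    · intro n
      refine ae_of_all _ fun x => ?_
      simp only
      gcongr
      rw [two_mul]
      refine enorm_sub_le.trans (add_le_add ?_ ?_)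
      · exact (enorm_integral_le_lintegral_enorm _).trans (lintegral_mono fun s => gCut_enorm_le _ _)
      · exact enorm_integral_le_lintegral_enorm _
    · simp_rw [mul_pow]
      rw [lintegral_const_mul _ ((meas_HH hm t).pow_const 2)]
      exact ENNReal.mul_ne_top (by simp) (HH_sq hg ht).ne
    · filter_upwards [hfin] with x hx
      have hI : Integrable (fun s : ℝ => g (fun j => s - x j))
          (volume.restrict (Set.Ioc (0 : ℝ) t)) :=
        ⟨(hsec hm x).aestronglyMeasurable, hx⟩
      have : Tendsto (fun n : ℕ => hKerCut g n t x) atTop (nhds (hKer g t x)) := by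
        apply tendsto_integral_of_dominated_convergence (fun s => ‖g (fun j => s - x j)‖)
        · intro n; exact (hsec (meas_gCut hm n) x).aestronglyMeasurable
        · exact hI.norm
        · intro n
          refine ae_of_all _ fun s => norm_indicator_le_norm_self _ _
        · exact ae_of_all _ fun s => gCut_tendsto hg _
      have h2 := ENNReal.Tendsto.pow (n := 2) (this.sub_const (hKer g t x)).enorm
      simpa using h2
  have h3 := (ENNReal.continuous_rpow_const (y := (1/2 : ℝ))).tendsto _ |>.comp key
  simp only [lintegral_zero, ENNReal.zero_rpow_of_pos (show (0:ℝ) < 1/2 by norm_num)] at h3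
  refine h3.congr fun n => ?_
  rw [eLpNorm_eq_lintegral_rpow_enorm_toReal (by simp) (by simp)]
  simp

lemma integrable_gCut (hg : IsGenHermiteKernel k α g)
    (hint : IntegrableOn (fun x => |g x|) {x : Fin k → ℝ | ∀ j, x j ∈ Set.Ioc (0 : ℝ) 1} volume)
    (n : ℕ) : Integrable (gCut g n) := by
  have h1 : Integrable (gCut g 1) := by
    rw [gCut, integrable_indicator_iff (meas_box k 1)]
    exact (integrable_norm_iff hg.measurable.aestronglyMeasurable).1 hint
  set r : ℝ := n + 1 with hr
  have hr0 : 0 < r := by positivity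
  have h2 : Integrable (gCut g r) := by
    rw [← integrable_comp_smul_iff volume _ hr0.ne']
    refine (h1.const_mul (r ^ α)).congr (ae_of_all _ fun x => ?_)
    simp only [gCut, Set.indicator, Set.mem_ofPred_eq, Pi.smul_apply, smul_eq_mul, Set.mem_Ioc]
    have : (∀ j, 0 < r * x j ∧ r * x j ≤ r) ↔ ∀ j, 0 < x j ∧ x j ≤ 1 := by
      refine forall_congr' fun j => and_congr (mul_pos_iff_of_pos_left hr0) ?_
      constructor <;> intro h <;> nlinarith
    simp only [this]
    split_ifs with h
    · rw [hg.homog r hr0 x fun j => (h j).1]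
    · simp
  refine h2.mono (meas_gCut hg.measurable n).aestronglyMeasurable (ae_of_all _ fun x => ?_)
  simp only [gCut]
  apply norm_indicator_le_of_subset
  intro y hy j
  exact ⟨(hy j).1, (hy j).2.trans (by rw [hr]; linarith)⟩

end

section
variable {k : ℕ} {α : ℝ} {g : (Fin k → ℝ) → ℝ}

lemma spec_eq (t : ℝ) (ht : 0 < t) (u : Fin k → ℝ) :
    ∫ s in Set.Ioc (0 : ℝ) t, Complex.exp (Complex.I * ((s * ∑ j, u j : ℝ) : ℂ)) =
      specFactor t u := by
  unfold specFactor
  split_ifs with h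
  · simp [h, ht.le]
  · have hc : Complex.I * ((∑ j, u j : ℝ) : ℂ) ≠ 0 :=
      mul_ne_zero Complex.I_ne_zero (by exact_mod_cast h)
    rw [← intervalIntegral.integral_of_le ht.le]
    have := integral_exp_mul_complex (a := 0) (b := t) hc
    simp only [Complex.ofReal_zero, mul_zero, Complex.exp_zero] at this
    convert this using 2
    · ext s; congr 1; push_cast; ring
    · congr 2; ring

lemma integrable_shift {f : (Fin k → ℝ) → ℝ} (hm : Measurable f) (hf : Integrable f) (t : ℝ) :
    Integrable (fun q : (Fin k → ℝ) × ℝ => f (fun j => q.2 - q.1 j))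
      (volume.prod (volume.restrict (Set.Ioc (0 : ℝ) t))) := by
  rw [integrable_prod_iff' (meas_shift hm).aestronglyMeasurable]
  constructor
  · refine ae_of_all _ fun s => ?_
    exact hf.comp_sub_left (fun _ => s)
  · have : ∀ s : ℝ, ∫ x : Fin k → ℝ, ‖f (fun j => s - x j)‖ = ∫ x, ‖f x‖ := fun s =>
      integral_sub_left_eq_self (fun x => ‖f x‖) volume (fun _ => s)
    simp only [this]
    exact integrable_const _

lemma integrable_hKer {f : (Fin k → ℝ) → ℝ} (hm : Measurable f) (hf : Integrable f) (t : ℝ) :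
    Integrable (hKer f t) :=
  (integrable_shift hm hf t).integral_prod_left

lemma FT_hKer {f : (Fin k → ℝ) → ℝ} (hm : Measurable f) (hf : Integrable f) {t : ℝ} (ht : 0 < t)
    (u : Fin k → ℝ) :
    FT (fun x => ((hKer f t x : ℝ) : ℂ)) u =
      specFactor t u * FT (fun x => (f x : ℂ)) (fun j => - u j) := by
  have hI := integrable_shift hm hf t
  have hexp : Measurable (fun x : Fin k → ℝ =>
      Complex.exp (Complex.I * ((∑ j, u j * x j : ℝ) : ℂ))) := by fun_prop
  have hI2 : Integrable (fun q : (Fin k → ℝ) × ℝ => (f (fun j => q.2 - q.1 j) : ℂ) *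
      Complex.exp (Complex.I * ((∑ j, u j * q.1 j : ℝ) : ℂ)))
      (volume.prod (volume.restrict (Set.Ioc (0 : ℝ) t))) := by
    refine hI.ofReal.mul_bdd (c := 1) (hexp.comp measurable_fst).aestronglyMeasurable
      (ae_of_all _ fun q => ?_)
    rw [mul_comm, Complex.norm_exp_ofReal_mul_I]
  have e1 : FT (fun x => ((hKer f t x : ℝ) : ℂ)) u = ∫ x : Fin k → ℝ, ∫ s in Set.Ioc (0 : ℝ) t,
      (f (fun j => s - x j) : ℂ) * Complex.exp (Complex.I * ((∑ j, u j * x j : ℝ) : ℂ)) := by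
    unfold FT hKer
    congr 1
    ext x
    simp only
    rw [← integral_complex_ofReal, ← integral_mul_const]
  rw [e1, integral_integral_swap hI2]
  have e2 : ∀ s : ℝ, ∫ x : Fin k → ℝ, (f (fun j => s - x j) : ℂ) *
      Complex.exp (Complex.I * ((∑ j, u j * x j : ℝ) : ℂ)) =
      Complex.exp (Complex.I * ((s * ∑ j, u j : ℝ) : ℂ)) *
        FT (fun x => (f x : ℂ)) (fun j => - u j) := by
    intro s
    rw [FT, ← integral_const_mul, ← integral_sub_left_eq_self _ volume (fun _ => s)]
    congr 1
    ext x
    have hx : (fun j => s - ((fun _ => s) - x : Fin k → ℝ) j) = x := by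
      ext j; simp
    rw [hx, mul_left_comm, ← Complex.exp_add]
    congr 2
    rw [← mul_add, ← Complex.ofReal_add]
    congr 2
    rw [Finset.mul_sum, ← Finset.sum_add_distrib]
    apply Finset.sum_congr rfl
    intro j _
    simp only [Pi.sub_apply]
    ring
  simp only [e2]
  rw [integral_mul_const, spec_eq t ht]

lemma gCutHat_eq (r : ℝ) : gCutHat g r = FT (fun x => (gCut g r x : ℂ)) := rfl

lemma meas_FT {f : (Fin k → ℝ) → ℂ} (hf : Measurable f) : Measurable (FT f) := by
  have : StronglyMeasurable (fun q : (Fin k → ℝ) × (Fin k → ℝ) =>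
      f q.2 * Complex.exp (Complex.I * ((∑ j, q.1 j * q.2 j : ℝ) : ℂ))) :=
    Measurable.stronglyMeasurable (by fun_prop)
  exact (this.integral_prod_right').measurable

lemma meas_spec (t : ℝ) : Measurable (specFactor (k := k) t) := by
  unfold specFactor
  refine Measurable.ite ?_ measurable_const (by fun_prop)
  exact (measurableSet_singleton (0 : ℝ)).preimage (f := fun u : Fin k → ℝ => ∑ j, u j)
    (by fun_prop)

lemma FT_sub {f₁ f₂ : (Fin k → ℝ) → ℂ} (h₁ : Integrable f₁) (h₂ : Integrable f₂)
    (u : Fin k → ℝ) : FT (fun x => f₁ x - f₂ x) u = FT f₁ u - FT f₂ u := by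
  have hexp : Measurable (fun x : Fin k → ℝ =>
      Complex.exp (Complex.I * ((∑ j, u j * x j : ℝ) : ℂ))) := by fun_prop
  have aux : ∀ {f : (Fin k → ℝ) → ℂ}, Integrable f → Integrable (fun x =>
      f x * Complex.exp (Complex.I * ((∑ j, u j * x j : ℝ) : ℂ))) := fun h => by
    refine h.mul_bdd (c := 1) hexp.aestronglyMeasurable (ae_of_all _ fun q => ?_)
    rw [mul_comm, Complex.norm_exp_ofReal_mul_I]
  unfold FT
  rw [← integral_sub (aux h₁) (aux h₂)]
  simp only [sub_mul]

lemma spec_ne_zero (hk : 1 ≤ k) : ∀ᵐ u : Fin k → ℝ, specFactor 1 u ≠ 0 := by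
  let L : (Fin k → ℝ) →ₗ[ℝ] ℝ := ∑ j, LinearMap.proj j
  have hL : ∀ u, L u = ∑ j, u j := fun u => by simp [L]
  have hsurj : Function.Surjective L := by
    intro c
    refine ⟨Pi.single ⟨0, hk⟩ c, ?_⟩
    rw [hL]; simp
  obtain ⟨c, -, hc⟩ := LinearMap.exists_map_addHaar_eq_smul_addHaar (L := L)
    (volume : Measure (Fin k → ℝ)) (volume : Measure ℝ) hsurj
  have hLm : Measurable L := L.continuous_of_finiteDimensional.measurable
  set S : Set ℝ := Set.range (fun n : ℤ => (n : ℝ) * (2 * Real.pi)) with hS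
  have hSc : S.Countable := Set.countable_range _
  have hnull : volume (L ⁻¹' S) = 0 := by
    rw [← Measure.map_apply hLm hSc.measurableSet, hc]
    simp [hSc.measure_zero]
  have : ∀ᵐ u, u ∉ L ⁻¹' S := measure_eq_zero_iff_ae_notMem.1 hnull
  filter_upwards [this] with u hu
  unfold specFactor
  have h0 : (∑ j, u j) ≠ 0 := by
    intro h
    exact hu ⟨0, by simp [hL, h]⟩
  rw [if_neg h0]
  refine div_ne_zero (fun h => ?_) (mul_ne_zero Complex.I_ne_zero (by exact_mod_cast h0))
  rw [sub_eq_zero, Complex.exp_eq_one_iff] at h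
  obtain ⟨n, hn⟩ := h
  apply hu
  refine ⟨n, ?_⟩
  have h2 : Complex.I * ((∑ j, u j : ℝ) : ℂ) = Complex.I * ((n * (2 * Real.pi) : ℝ) : ℂ) := by
    rw [Complex.ofReal_one, mul_one] at hn
    rw [hn]; push_cast; ring
  have h3 := mul_left_cancel₀ Complex.I_ne_zero h2
  rw [hL]
  exact_mod_cast h3.symm

end

theorem stmt6 {k : ℕ} (hk : 1 ≤ k) {α : ℝ} {g : (Fin k → ℝ) → ℝ}
    (hg : IsGenHermiteKernel k α g)
    (hint : IntegrableOn (fun x => |g x|) {x : Fin k → ℝ | ∀ j, x j ∈ Set.Ioc (0 : ℝ) 1} volume)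
    {t : ℝ} (ht : 0 < t) :
    Tendsto (fun n : ℕ =>
        eLpNorm (fun x => hKerCut g n t x - hKer g t x) 2 volume) atTop (nhds 0) ∧
    ∃ ghat : (Fin k → ℝ) → ℂ, Measurable ghat ∧
      (∀ t' : ℝ, 0 < t' →
        Tendsto (fun n : ℕ =>
            eLpNorm (fun u : Fin k → ℝ =>
              specFactor t' u * (gCutHat g n (fun j => -u j) - ghat (fun j => -u j)))
              2 volume)
          atTop (nhds 0)) ∧
      ∃ φ : ℕ → ℕ, StrictMono φ ∧
        ∀ᵐ u : Fin k → ℝ, Tendsto (fun m => gCutHat g (φ m) u) atTop (nhds (ghat u)) := by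
  refine ⟨part_i hg ht, ?_⟩
  have hm := hg.measurable
  obtain ⟨c, hc, hP⟩ := planch k
  set a : ℝ → ℕ → ENNReal := fun t' n =>
    eLpNorm (fun x => hKerCut g n t' x - hKer g t' x) 2 volume with ha
  have hat : ∀ t', 0 < t' → Tendsto (a t') atTop (nhds 0) := fun t' ht' => part_i hg ht'
  have hmh : ∀ r : ℝ, Measurable (gCutHat g r) := fun r =>
    meas_FT (Complex.measurable_ofReal.comp (meas_gCut hm r))
  have hneg : Measurable (fun u : Fin k → ℝ => fun j => - u j) := measurable_neg
  -- Plancherel bound for differences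
  have bound : ∀ t', 0 < t' → ∀ n m : ℕ, eLpNorm (fun u : Fin k → ℝ => specFactor t' u *
      (gCutHat g n (fun j => -u j) - gCutHat g m (fun j => -u j))) 2 volume ≤
      c * (a t' n + a t' m) := by
    intro t' ht' n m
    have hI : ∀ n : ℕ, Integrable (fun x => ((hKerCut g n t' x : ℝ) : ℂ)) := fun n =>
      (integrable_hKer (meas_gCut hm n) (integrable_gCut hg hint n) t').ofReal
    have e : (fun u : Fin k → ℝ => specFactor t' u *
        (gCutHat g n (fun j => -u j) - gCutHat g m (fun j => -u j))) =
        FT (fun x => ((hKerCut g n t' x : ℝ) : ℂ) - ((hKerCut g m t' x : ℝ) : ℂ)) := by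
      ext u
      rw [FT_sub (hI n) (hI m)]
      simp only [hKerCut_eq]
      rw [FT_hKer (meas_gCut hm n) (integrable_gCut hg hint n) ht',
        FT_hKer (meas_gCut hm m) (integrable_gCut hg hint m) ht', mul_sub]
      rfl
    rw [e]
    refine (hP (fun x => ((hKerCut g n t' x : ℝ) : ℂ) - ((hKerCut g m t' x : ℝ) : ℂ))
      ((hI n).sub (hI m))).trans ?_
    gcongr
    have e2 : eLpNorm (fun x => ((hKerCut g n t' x : ℝ) : ℂ) - ((hKerCut g m t' x : ℝ) : ℂ)) 2
        volume = eLpNorm ((fun x => hKerCut g n t' x - hKer g t' x) -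
          (fun x => hKerCut g m t' x - hKer g t' x)) 2 volume := by
      apply eLpNorm_congr_norm_ae
      refine ae_of_all _ fun x => ?_
      rw [← Complex.ofReal_sub, Complex.norm_real]
      simp
    rw [e2]
    have hsm : ∀ n : ℕ, AEStronglyMeasurable (fun x => hKerCut g n t' x - hKer g t' x) volume :=
      fun n => ((meas_hKer (meas_gCut hm n) t').sub (meas_hKer hm t')).aestronglyMeasurable
    exact eLpNorm_sub_le (hsm n) (hsm m) (by norm_num)
  -- choose subsequence
  have hca : Tendsto (fun n => c * (a 1 n)) atTop (nhds 0) := by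
    have := ENNReal.Tendsto.const_mul (a := c) (hat 1 one_pos) (Or.inr hc)
    simpa using this
  set ε : ℕ → ENNReal := fun n => (1 / 2) ^ n with hε
  have hε0 : ∀ n, 0 < ε n := fun n => by
    simp only [hε]; exact ENNReal.pow_pos (by simp) n
  have hεt : ∀ n, ε n ≠ ⊤ := fun n => by
    simp only [hε]; exact ENNReal.pow_ne_top (by simp)
  have hεm : Antitone ε := fun i j hij => by
    simp only [hε]; exact pow_le_pow_of_le_one (by simp) (by simp) hij
  obtain ⟨φ, hφ, hφb⟩ : ∃ φ : ℕ → ℕ, StrictMono φ ∧ ∀ n, c * a 1 (φ n) < ε n := by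
    apply extraction_forall_of_eventually (P := fun n m => c * a 1 m < ε n)
    intro n
    exact hca.eventually_lt_const (hε0 n)
  have hspecm := meas_spec (k := k)
  have hae1 : ∀ᵐ u : Fin k → ℝ, ∃ l : ℂ, Tendsto (fun m => specFactor 1 u *
      gCutHat g (φ m) (fun j => -u j)) atTop (nhds l) := by
    apply Lp.ae_tendsto_of_cauchy_eLpNorm (p := 2) (B := fun n => 2 * ε n)
      (f := fun m u => specFactor 1 u * gCutHat g (φ m) (fun j => -u j))
    · intro m
      exact ((hspecm 1).mul ((hmh _).comp hneg)).aestronglyMeasurable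
    · norm_num
    · rw [ENNReal.tsum_mul_left]
      refine ENNReal.mul_ne_top (by simp) ?_
      simp only [hε]
      rw [ENNReal.tsum_geometric]
      simp
    · intro N n m hn hm'
      have e : ((fun u : Fin k → ℝ => specFactor 1 u * gCutHat g (φ n) (fun j => -u j)) -
          (fun u => specFactor 1 u * gCutHat g (φ m) (fun j => -u j))) =
          (fun u : Fin k → ℝ => specFactor 1 u *
      (gCutHat g (φ n) (fun j => -u j) - gCutHat g (φ m) (fun j => -u j))) := by
        ext u; simp [mul_sub]
      rw [e]
      refine (bound 1 one_pos _ _).trans_lt ?_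
      rw [mul_add, two_mul]
      exact ENNReal.add_lt_add ((hφb n).trans_le (hεm hn)) ((hφb m).trans_le (hεm hm'))
  have hae2 : ∀ᵐ u : Fin k → ℝ, ∃ l : ℂ, Tendsto (fun m => 
      gCutHat g (φ m) (fun j => -u j)) atTop (nhds l) := by
    filter_upwards [hae1, spec_ne_zero hk] with u ⟨l, hl⟩ h0
    refine ⟨(specFactor 1 u)⁻¹ * l, (hl.const_mul (specFactor 1 u)⁻¹).congr fun m => ?_⟩
    rw [inv_mul_cancel_left₀ h0]
  have hnq : Measure.QuasiMeasurePreserving (fun u : Fin k → ℝ => fun j => - u j) volume volume :=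
    (Measure.measurePreserving_neg (volume : Measure (Fin k → ℝ))).quasiMeasurePreserving
  have hae3 : ∀ᵐ u : Fin k → ℝ, ∃ l : ℂ, Tendsto (fun m => gCutHat g (φ m) u) atTop (nhds l) := by
    have := hnq.ae hae2
    simpa using this
  obtain ⟨ghat, hgm, hgl⟩ := measurable_limit_of_tendsto_metrizable_ae
    (fun n => (hmh (φ n)).aemeasurable) hae3
  refine ⟨ghat, hgm, fun t' ht' => ?_, φ, hφ, hgl⟩
  have hlim := hnq.ae hgl
  have up : ∀ n : ℕ, eLpNorm (fun u : Fin k → ℝ =>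
      specFactor t' u * (gCutHat g n (fun j => -u j) - ghat (fun j => -u j))) 2 volume ≤
      c * a t' n := by
    intro n
    refine (Lp.eLpNorm_lim_le_liminf_eLpNorm (f := fun m (u : Fin k → ℝ) => specFactor t' u *
      (gCutHat g n (fun j => -u j) - gCutHat g (φ m) (fun j => -u j))) ?_ _ ?_).trans ?_
    · intro m
      exact ((hspecm t').mul (((hmh _).comp hneg).sub ((hmh _).comp hneg))).aestronglyMeasurable
    · filter_upwards [hlim] with u hu
      exact (hu.const_sub _).const_mul _
    · refine (liminf_le_liminf (Eventually.of_forall fun m => bound t' ht' n (φ m))).trans ?_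
      have h1 : Tendsto (fun m => c * (a t' n + a t' (φ m))) atTop (nhds (c * (a t' n + 0))) :=
        ENNReal.Tendsto.const_mul
          (tendsto_const_nhds.add ((hat t' ht').comp hφ.tendsto_atTop)) (Or.inr hc)
      rw [h1.liminf_eq, add_zero]
  have hca' : Tendsto (fun n => c * (a t' n)) atTop (nhds 0) := by
    have := ENNReal.Tendsto.const_mul (a := c) (hat t' ht') (Or.inr hc)
    simpa using this
  exact tendsto_of_tendsto_of_tendsto_of_le_of_le tendsto_const_nhds hca' (fun _ => zero_le) up
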